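/- Fix an integer k > 1. For each n ≥ 1 let S_{k,n} be the bidirectional spider with k legs each of length n and all edge weights equal: a center c and, for each leg i, a path c — v_{i,1} — ⋯ — v_{i,n} with both directed edges present on every adjacent pair, all with the same positive weight. Then ept_rzf(S_{k,n}) = 2n(1+o(1)) as n → ∞; more precisely, 2n − 1 ≤ ept_rzf(S_{k,n}) ≤ 2n − 1 + C_k √n for a constant C_k depending only on k, so lim_{n→∞} ept_rzf(S_{k,n})/(2n) = 1. -/

import Mathlib

open scoped ENNReal NNReal

namespace RZF

variable {V : Type*} [Fintype V] [DecidableEq V]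

/-- Probability that the white vertex `x` turns blue in one round of weighted
randomized zero forcing with weights `w`, given the current blue set `B`
(`0` when the total incoming weight of `x` is `0`). -/
noncomputable def turnProb (w : V → V → ℝ≥0) (B : Finset V) (x : V) : ℝ≥0 :=
  (∑ u ∈ B, w u x) / ∑ u, w u x

/-- One-round transition probability of the RZF Markov chain from blue set `B`
to blue set `C`: each white vertex independently turns blue with probability
`turnProb w B ·`, and blue vertices stay blue. -/
noncomputable def stepProb (w : V → V → ℝ≥0) (B C : Finset V) : ℝ≥0∞ :=
  if B ⊆ C then
    (∏ x ∈ C \ B, (turnProb w B x : ℝ≥0∞)) *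
      ∏ x ∈ Cᶜ, (1 - (turnProb w B x : ℝ≥0∞))
  else 0

/-- Distribution of the blue set after `t` rounds, started from `S`. -/
noncomputable def state (w : V → V → ℝ≥0) (S : Finset V) : ℕ → Finset V → ℝ≥0∞
  | 0 => fun C => if C = S then 1 else 0
  | t + 1 => fun C => ∑ B : Finset V, state w S t B * stepProb w B C

/-- Expected propagation time `∑ₜ P(Bₜ ≠ V(G))`; this equals `E[τ]` when the
all-blue state is reachable from `S`, and `∞` otherwise. -/
noncomputable def ept (w : V → V → ℝ≥0) (S : Finset V) : ℝ≥0∞ :=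
  ∑' t : ℕ, ∑ C ∈ Finset.univ.filter (fun C : Finset V => C ≠ Finset.univ),
    state w S t C

/-- Minimum expected propagation time over singleton starting sets. -/
noncomputable def eptMin (w : V → V → ℝ≥0) : ℝ≥0∞ :=
  ⨅ v : V, ept w {v}

/-- The weight function of an unweighted directed graph: weight `1` on each
edge and `0` otherwise, so that `turnProb` is the fraction of in-neighbors
that are blue. -/
def unweight (adj : V → V → Prop) [DecidableRel adj] : V → V → ℝ≥0 :=
  fun u v => if adj u v then 1 else 0

end RZF

/-- `reachIn adj t a b` : there is a directed path of length at most `t`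
from `a` to `b` in the directed graph with adjacency relation `adj`. -/
def reachIn {V : Type*} (adj : V → V → Prop) : ℕ → V → V → Prop
  | 0, a, b => a = b
  | t + 1, a, b => reachIn adj t a b ∨ ∃ c, reachIn adj t a c ∧ adj c b

/-- The weight function of the bidirectional spider with `k` legs of length
`n`, all edges of the same positive weight `c`: `none` is the center and
`some (i, j)` is the `(j+1)`-st vertex of leg `i`. -/
noncomputable def spiderWeight (k n : ℕ) (c : ℝ≥0) :
    Option (Fin k × Fin n) → Option (Fin k × Fin n) → ℝ≥0
  | none, some x => if (x.2 : ℕ) = 0 then c else 0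
  | some x, none => if (x.2 : ℕ) = 0 then c else 0
  | some x, some y =>
      if x.1 = y.1 ∧ ((x.2 : ℕ) + 1 = (y.2 : ℕ) ∨ (y.2 : ℕ) + 1 = (x.2 : ℕ))
      then c else 0
  | none, none => 0

namespace RZF

section Chain

variable {V : Type*} [Fintype V] (w : V → V → ℝ≥0)

theorem turnProb_le_one (B : Finset V) (x : V) : turnProb w B x ≤ 1 := by
  unfold turnProb
  apply div_le_one_of_le₀ _ (zero_le)
  exact Finset.sum_le_sum_of_subset (Finset.subset_univ B)

variable [DecidableEq V]

/-- Probability that `x` is blue after one round from `B`. -/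
noncomputable def blueProb (B : Finset V) (x : V) : ℝ≥0∞ :=
  if x ∈ B then 1 else (turnProb w B x : ℝ≥0∞)

/-- Probability that `x` is white after one round from `B`. -/
noncomputable def whiteProb (B : Finset V) (x : V) : ℝ≥0∞ :=
  if x ∈ B then 0 else 1 - (turnProb w B x : ℝ≥0∞)

theorem blueProb_add_whiteProb (B : Finset V) (x : V) :
    blueProb w B x + whiteProb w B x = 1 := by
  unfold blueProb whiteProb
  split_ifs
  · simp
  · exact add_tsub_cancel_of_le (by exact_mod_cast turnProb_le_one w B x)

theorem stepProb_eq_prod (B C : Finset V) :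
    stepProb w B C = (∏ x ∈ C, blueProb w B x) * ∏ x ∈ Cᶜ, whiteProb w B x := by
  unfold stepProb
  split_ifs with h
  · congr 1
    · rw [← Finset.prod_sdiff h, Finset.prod_congr rfl (g := fun _ => (1 : ℝ≥0∞)) (s₁ := B)
        (fun x hx => by simp [blueProb, hx])]
      simp only [Finset.prod_const_one, mul_one]
      refine Finset.prod_congr rfl fun x hx => ?_
      simp [blueProb, (Finset.mem_sdiff.mp hx).2]
    · refine Finset.prod_congr rfl fun x hx => ?_
      have : x ∉ B := fun hB => Finset.mem_compl.mp hx (h hB)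
      simp [whiteProb, this]
  · obtain ⟨x, hxB, hxC⟩ := Finset.not_subset.mp h
    rw [Finset.prod_eq_zero (Finset.mem_compl.mpr hxC) (by simp [whiteProb, hxB]), mul_zero]

theorem sum_prod_mul_prod_compl (f g : V → ℝ≥0∞) :
    ∑ C : Finset V, (∏ x ∈ C, f x) * ∏ x ∈ Cᶜ, g x = ∏ x, (f x + g x) := by
  rw [Finset.prod_add, Finset.powerset_univ]
  rfl

theorem sum_stepProb (B : Finset V) : ∑ C, stepProb w B C = 1 := by
  simp only [stepProb_eq_prod, sum_prod_mul_prod_compl, blueProb_add_whiteProb,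
    Finset.prod_const_one]

theorem sum_stepProb_mul_ite (B : Finset V) (x : V) (a b : ℝ≥0∞) :
    ∑ C, stepProb w B C * (if x ∈ C then a else b) =
      blueProb w B x * a + whiteProb w B x * b := by
  have key : ∀ C : Finset V, stepProb w B C * (if x ∈ C then a else b) =
      (∏ y ∈ C, blueProb w B y * (if y = x then a else 1)) *
        ∏ y ∈ Cᶜ, whiteProb w B y * (if y = x then b else 1) := by
    intro C
    rw [stepProb_eq_prod, Finset.prod_mul_distrib, Finset.prod_mul_distrib,
      Finset.prod_ite_eq', Finset.prod_ite_eq', mul_mul_mul_comm]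
    by_cases h : x ∈ C <;> simp [h]
  rw [Finset.sum_congr rfl fun C _ => key C, sum_prod_mul_prod_compl,
    Finset.prod_eq_single x]
  · simp
  · intro y _ hy
    simp [hy, blueProb_add_whiteProb]
  · simp

theorem subset_of_stepProb_ne_zero {B C : Finset V} (h : stepProb w B C ≠ 0) : B ⊆ C := by
  by_contra hBC
  exact h (by simp [stepProb, hBC])

theorem exists_weight_ne_zero_of_stepProb_ne_zero {B C : Finset V} (h : stepProb w B C ≠ 0)
    {x : V} (hC : x ∈ C) (hB : x ∉ B) : ∃ u ∈ B, w u x ≠ 0 := by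
  rw [stepProb_eq_prod] at h
  have h1 := Finset.prod_ne_zero_iff.mp (left_ne_zero_of_mul h) x hC
  by_contra! h2
  apply h1
  simp [blueProb, hB, turnProb, Finset.sum_eq_zero h2]

theorem sum_state_succ_mul (S : Finset V) (t : ℕ) (f : Finset V → ℝ≥0∞) :
    ∑ C, state w S (t + 1) C * f C =
      ∑ B, state w S t B * ∑ C, stepProb w B C * f C := by
  simp only [state, Finset.sum_mul, Finset.mul_sum, mul_assoc]
  exact Finset.sum_comm

theorem sum_state (S : Finset V) (t : ℕ) : ∑ C, state w S t C = 1 := by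
  induction t with
  | zero => simp [state]
  | succ t ih => simpa [sum_stepProb, ih] using sum_state_succ_mul w S t (fun _ => 1)

theorem subset_of_state_ne_zero {S : Finset V} {t : ℕ} {C : Finset V}
    (h : state w S t C ≠ 0) : S ⊆ C := by
  induction t generalizing C with
  | zero =>
    have : C = S := by
      by_contra hC
      exact h (by simp [state, hC])
    exact this.ge
  | succ t ih =>
    obtain ⟨B, -, hB⟩ := Finset.exists_ne_zero_of_sum_ne_zero h
    exact (ih (left_ne_zero_of_mul hB)).trans
      (subset_of_stepProb_ne_zero w (right_ne_zero_of_mul hB))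

/-- Probability that some vertex is still white after `t` rounds. -/
noncomputable def unfinishedProb (S : Finset V) (t : ℕ) : ℝ≥0∞ :=
  ∑ C ∈ Finset.univ.filter (fun C : Finset V => C ≠ Finset.univ), state w S t C

theorem ept_eq_tsum (S : Finset V) : ept w S = ∑' t, unfinishedProb w S t := rfl

theorem unfinishedProb_eq (S : Finset V) (t : ℕ) :
    unfinishedProb w S t =
      ∑ C, state w S t C * (if C ≠ Finset.univ then 1 else 0) := by
  simp only [unfinishedProb, Finset.sum_filter, mul_ite, mul_one, mul_zero]

theorem unfinishedProb_le_one (S : Finset V) (t : ℕ) : unfinishedProb w S t ≤ 1 :=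
  (Finset.sum_le_sum_of_subset (Finset.filter_subset _ _)).trans (sum_state w S t).le

/-- A bounded potential decreasing by at most `1` per round on average bounds the expected
propagation time from below. -/
theorem le_ept_of_drift (φ : Finset V → ℝ≥0∞) (M : ℝ≥0∞) (hM : M ≠ ⊤)
    (hφM : ∀ B, φ B ≤ M) (hφ : φ Finset.univ = 0)
    (hstep : ∀ B, φ B ≤ 1 + ∑ C, stepProb w B C * φ C) (S : Finset V) :
    φ S ≤ ept w S := by
  have hstep' : ∀ B, φ B ≤
      (if B ≠ Finset.univ then 1 else 0) + ∑ C, stepProb w B C * φ C := by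
    intro B
    by_cases hB : B = Finset.univ
    · simp [hB, hφ]
    · simpa [hB] using hstep B
  have hT : ∀ T, φ S ≤
      ∑ t ∈ Finset.range T, unfinishedProb w S t + ∑ C, state w S T C * φ C := by
    intro T
    induction T with
    | zero => simp [state]
    | succ T ih =>
      refine ih.trans ?_
      rw [Finset.sum_range_succ, add_assoc, sum_state_succ_mul, unfinishedProb_eq,
        ← Finset.sum_add_distrib]
      gcongr with B
      rw [← mul_add]
      gcongr
      exact hstep' B
  have hM' : ∀ T, ∑ C, state w S T C * φ C ≤ unfinishedProb w S T * M := by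
    intro T
    rw [unfinishedProb_eq, Finset.sum_mul]
    refine Finset.sum_le_sum fun C _ => ?_
    rw [mul_assoc]
    gcongr
    by_cases hC : C = Finset.univ
    · simp [hC, hφ]
    · simpa [hC] using hφM C
  by_cases hfin : ept w S = ⊤
  · simp [hfin]
  have htend : Filter.Tendsto (fun T => ept w S + unfinishedProb w S T * M) Filter.atTop
      (nhds (ept w S + 0 * M)) :=
    tendsto_const_nhds.add
      (ENNReal.Tendsto.mul_const (ENNReal.tendsto_atTop_zero_of_tsum_ne_top hfin) (Or.inr hM))
  rw [zero_mul, add_zero] at htend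
  refine ge_of_tendsto' htend fun T => (hT T).trans ?_
  exact add_le_add (ENNReal.sum_le_tsum _) (hM' T)

/-- A potential contracted by the factor `ρ` on average and at least `1` on unfinished states
bounds the probability of being unfinished. -/
theorem unfinishedProb_le_of_contraction (S : Finset V) (Φ : Finset V → ℝ≥0∞) (ρ : ℝ≥0∞)
    (hΦ : ∀ C, S ⊆ C → C ≠ Finset.univ → 1 ≤ Φ C)
    (hstep : ∀ B, S ⊆ B → ∑ C, stepProb w B C * Φ C ≤ ρ * Φ B) (t : ℕ) :
    unfinishedProb w S t ≤ ρ ^ t * Φ S := by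
  have hE : ∑ C, state w S t C * Φ C ≤ ρ ^ t * Φ S := by
    induction t with
    | zero => simp [state]
    | succ t ih =>
      rw [sum_state_succ_mul, pow_succ', mul_assoc]
      refine le_trans ?_ (mul_le_mul_right ih ρ)
      rw [Finset.mul_sum]
      refine Finset.sum_le_sum fun B _ => ?_
      by_cases h0 : state w S t B = 0
      · simp [h0]
      · rw [mul_left_comm]
        exact mul_le_mul_right (hstep B (subset_of_state_ne_zero w h0)) _
  refine le_trans ?_ hE
  rw [unfinishedProb_eq]
  refine Finset.sum_le_sum fun C _ => ?_
  by_cases h0 : state w S t C = 0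
  · simp [h0]
  gcongr
  split_ifs with hC
  · exact hΦ C (subset_of_state_ne_zero w h0) hC
  · exact zero_le

theorem ept_le_of_geometric (S : Finset V) (N : ℕ) (ρ A : ℝ≥0∞)
    (h : ∀ t, unfinishedProb w S (t + N) ≤ ρ ^ t * A) :
    ept w S ≤ N + (1 - ρ)⁻¹ * A := by
  rw [ept_eq_tsum, ← ENNReal.summable.sum_add_tsum_nat_add' (k := N)]
  refine add_le_add ?_ ?_
  · simpa using Finset.sum_le_sum fun t (_ : t ∈ Finset.range N) => unfinishedProb_le_one w S t
  · rw [← ENNReal.tsum_geometric, ← ENNReal.tsum_mul_right]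
    exact ENNReal.tsum_le_tsum h

end Chain

end RZF

section Spider

open RZF

variable {k n : ℕ} {c : ℝ≥0}

/-- The neighbour towards the center. -/
def spiderPred : Fin k × Fin n → Option (Fin k × Fin n)
  | (i, j) => if (j : ℕ) = 0 then none else some (i, ⟨j - 1, by omega⟩)

theorem spiderWeight_some (u : Option (Fin k × Fin n)) (i : Fin k) (j : Fin n) :
    spiderWeight k n c u (some (i, j)) =
      (if u = spiderPred (i, j) then c else 0) +
        if h : (j : ℕ) + 1 < n then (if u = some (i, ⟨j + 1, h⟩) then c else 0) else 0 := by
  rcases u with _ | ⟨i', j'⟩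
  · by_cases h : (j : ℕ) = 0 <;> simp [spiderWeight, spiderPred, h]
  · have := j'.2
    simp only [spiderWeight, spiderPred]
    split_ifs <;> simp_all [Fin.ext_iff] <;> grind

theorem sum_spiderWeight_some (B : Finset (Option (Fin k × Fin n))) (i : Fin k) (j : Fin n) :
    ∑ u ∈ B, spiderWeight k n c u (some (i, j)) =
      (if spiderPred (i, j) ∈ B then c else 0) +
        if h : (j : ℕ) + 1 < n then (if some (i, ⟨j + 1, h⟩) ∈ B then c else 0) else 0 := by
  simp only [spiderWeight_some, Finset.sum_add_distrib, Finset.sum_ite_eq']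
  congr 1
  split_ifs <;> simp_all

theorem half_le_turnProb (hc : 0 < c) (B : Finset (Option (Fin k × Fin n))) (i : Fin k)
    (j : Fin n) (h : spiderPred (i, j) ∈ B) :
    1 / 2 ≤ turnProb (spiderWeight k n c) B (some (i, j)) := by
  unfold turnProb
  rw [sum_spiderWeight_some, sum_spiderWeight_some]
  simp only [h, Finset.mem_univ, if_true]
  rw [div_le_div_iff₀ (by norm_num) (by positivity)]
  split_ifs <;> simp [mul_two]

theorem turnProb_le_half (hc : 0 < c) (B : Finset (Option (Fin k × Fin n))) (i : Fin k)
    (j : Fin n) (hj : (j : ℕ) + 1 < n) (h : some (i, ⟨j + 1, hj⟩) ∉ B) :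
    turnProb (spiderWeight k n c) B (some (i, j)) ≤ 1 / 2 := by
  unfold turnProb
  rw [sum_spiderWeight_some, sum_spiderWeight_some]
  simp only [h, hj, Finset.mem_univ, if_true, dif_pos, if_false, add_zero]
  rw [div_le_div_iff₀ (by positivity) (by norm_num)]
  split_ifs <;> simp [mul_two]

/-- The distance from the center reached by the blue set along leg `i`. -/
def legReach (i : Fin k) (B : Finset (Option (Fin k × Fin n))) : ℕ :=
  (Finset.univ.filter fun j : Fin n => some (i, j) ∈ B).sup fun j => (j : ℕ) + 1

theorem legReach_le_iff (i : Fin k) (B : Finset (Option (Fin k × Fin n))) (m : ℕ) :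
    legReach i B ≤ m ↔ ∀ j : Fin n, some (i, j) ∈ B → (j : ℕ) + 1 ≤ m := by
  simp [legReach]

theorem succ_le_legReach {i : Fin k} {B : Finset (Option (Fin k × Fin n))} {j : Fin n}
    (h : some (i, j) ∈ B) : (j : ℕ) + 1 ≤ legReach i B :=
  (legReach_le_iff i B _).mp le_rfl j h

theorem legReach_le_of_stepProb_ne_zero (i : Fin k) {B C : Finset (Option (Fin k × Fin n))}
    (h : stepProb (spiderWeight k n c) B C ≠ 0) : legReach i C ≤ legReach i B + 1 := by
  rw [legReach_le_iff]
  intro j hj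
  by_cases hB : some (i, j) ∈ B
  · exact (succ_le_legReach hB).trans (Nat.le_succ _)
  obtain ⟨u, huB, hu⟩ := exists_weight_ne_zero_of_stepProb_ne_zero _ h hj hB
  rcases u with _ | ⟨i', j'⟩
  · have : (j : ℕ) = 0 := by
      by_contra h0
      exact hu (by simp [spiderWeight, h0])
    omega
  · have h' : i' = i ∧ ((j' : ℕ) + 1 = j ∨ (j : ℕ) + 1 = j') := by
      by_contra h0
      exact hu (by simp only [spiderWeight, if_neg h0])
    obtain ⟨rfl, h'⟩ := h'
    have := succ_le_legReach huB
    omega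

theorem le_ept_spider (hc : 0 < c) (i : Fin k) (S : Finset (Option (Fin k × Fin n))) :
    ((2 * (n - legReach i S) - 1 : ℕ) : ℝ≥0∞) ≤ ept (spiderWeight k n c) S := by
  refine le_ept_of_drift _ (fun B => ((2 * (n - legReach i B) - 1 : ℕ) : ℝ≥0∞))
    ((2 * n : ℕ) : ℝ≥0∞) (ENNReal.natCast_ne_top _) (fun B => ?_) ?_ (fun B => ?_) S
  · exact_mod_cast (by omega : 2 * (n - legReach i B) - 1 ≤ 2 * n)
  · have : n ≤ legReach i (Finset.univ : Finset (Option (Fin k × Fin n))) := by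
      rcases n with _ | n
      · simp
      · exact succ_le_legReach (j := Fin.last n) (Finset.mem_univ _)
    simp [Nat.sub_eq_zero_of_le this]
  · set w := spiderWeight k n c
    by_cases hm : legReach i B + 1 < n
    swap
    · refine le_trans ?_ le_self_add
      exact_mod_cast (by omega : 2 * (n - legReach i B) - 1 ≤ 1)
    set x : Option (Fin k × Fin n) := some (i, ⟨legReach i B, by omega⟩) with hx
    have hxB : x ∉ B := fun h => by simpa using succ_le_legReach h
    have hturn : turnProb w B x ≤ 1 / 2 :=
      turnProb_le_half hc B i _ hm fun h => by
        have := succ_le_legReach h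
        simp at this
    have hblue : blueProb w B x * 2 ≤ 1 := by
      have : turnProb w B x * 2 ≤ 1 := by
        calc _ ≤ (1 / 2 : ℝ≥0) * 2 := by gcongr
          _ = 1 := by norm_num
      simp only [blueProb, hxB, if_false]
      exact_mod_cast this
    have hsum : ((2 * (n - legReach i B) - 1 : ℕ) : ℝ≥0∞) ≤
        ∑ C, stepProb w B C * (((2 * (n - legReach i C) - 1 : ℕ) : ℝ≥0∞) +
          if x ∈ C then 2 else 0) := by
      calc _ = ∑ C, stepProb w B C * ((2 * (n - legReach i B) - 1 : ℕ) : ℝ≥0∞) := by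
            rw [← Finset.sum_mul, sum_stepProb, one_mul]
        _ ≤ _ := by
            refine Finset.sum_le_sum fun C _ => ?_
            by_cases h0 : stepProb w B C = 0
            · simp [h0]
            gcongr
            have h1 := legReach_le_of_stepProb_ne_zero i h0
            split_ifs with hC
            · exact_mod_cast (by omega :
                2 * (n - legReach i B) - 1 ≤ 2 * (n - legReach i C) - 1 + 2)
            · have h2 : legReach i C ≤ legReach i B := by
                rw [legReach_le_iff]
                intro j hj
                have := succ_le_legReach hj
                by_contra h3
                have : j = ⟨legReach i B, by omega⟩ := Fin.ext (by simp; omega)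
                exact hC (by rw [hx, ← this]; exact hj)
              rw [add_zero]
              exact_mod_cast (by omega :
                2 * (n - legReach i B) - 1 ≤ 2 * (n - legReach i C) - 1)
    simp only [mul_add, Finset.sum_add_distrib, sum_stepProb_mul_ite, mul_zero, add_zero] at hsum
    rw [add_comm]
    exact hsum.trans (by gcongr)

theorem le_eptMin_spider (hk : 1 < k) (hc : 0 < c) :
    ((2 * n - 1 : ℕ) : ℝ≥0∞) ≤ eptMin (spiderWeight k n c) := by
  refine le_iInf fun v => ?_
  obtain ⟨i, hi⟩ : ∃ i : Fin k, ∀ j, v ≠ some (i, j) := by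
    have : Nontrivial (Fin k) := Fin.nontrivial_iff_two_le.mpr hk
    rcases v with _ | ⟨i', j'⟩
    · exact ⟨⟨0, by omega⟩, by simp⟩
    · obtain ⟨i, hi⟩ := exists_ne i'
      exact ⟨i, fun j h => hi (by simp_all)⟩
  have h0 : legReach i {v} = 0 := by
    rw [← Nat.le_zero, legReach_le_iff]
    intro j hj
    exact absurd (Finset.mem_singleton.mp hj).symm (hi j)
  simpa [h0] using le_ept_spider hc i {v}

/-- The number of white vertices on leg `i`. -/
def legWhite (i : Fin k) (B : Finset (Option (Fin k × Fin n))) : ℕ :=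
  (Finset.univ.filter fun j : Fin n => some (i, j) ∉ B).card

/-- The exponential potential of leg `i`, vanishing once the leg is blue. -/
noncomputable def legPotential (β : ℝ≥0) (i : Fin k) (B : Finset (Option (Fin k × Fin n))) :
    ℝ≥0 :=
  if legWhite i B = 0 then 0 else β ^ legWhite i B

theorem legPotential_le (β : ℝ≥0) (i : Fin k) (B : Finset (Option (Fin k × Fin n))) :
    legPotential β i B ≤ β ^ legWhite i B := by
  unfold legPotential
  split_ifs <;> simp

theorem legWhite_anti {B C : Finset (Option (Fin k × Fin n))} (i : Fin k) (h : B ⊆ C) :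
    legWhite i C ≤ legWhite i B :=
  Finset.card_le_card fun j => by
    simp only [Finset.mem_filter, Finset.mem_univ, true_and]
    exact fun hj hB => hj (h hB)

theorem legWhite_lt {B C : Finset (Option (Fin k × Fin n))} {i : Fin k} {j : Fin n}
    (h : B ⊆ C) (hB : some (i, j) ∉ B) (hC : some (i, j) ∈ C) :
    legWhite i C < legWhite i B := by
  refine Finset.card_lt_card (Finset.ssubset_iff_of_subset ?_ |>.mpr ⟨j, by simpa, by simpa⟩)
  intro j
  simp only [Finset.mem_filter, Finset.mem_univ, true_and]
  exact fun hj hB => hj (h hB)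

theorem exists_first_white {B : Finset (Option (Fin k × Fin n))} (hB : none ∈ B) {i : Fin k}
    (h : legWhite i B ≠ 0) : ∃ j, some (i, j) ∉ B ∧ spiderPred (i, j) ∈ B := by
  obtain ⟨j, hj⟩ := Finset.card_ne_zero.mp h
  obtain ⟨m, hm, hmin⟩ := Finset.exists_min_image _ id ⟨j, hj⟩
  simp only [Finset.mem_filter, Finset.mem_univ, true_and, id] at hm hmin
  refine ⟨m, hm, ?_⟩
  simp only [spiderPred]
  split_ifs with h0
  · exact hB
  · by_contra hp
    have := hmin _ hp
    rw [Fin.le_def] at this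
    simp at this
    omega

theorem sum_stepProb_mul_legPotential_le (hc : 0 < c) {β : ℝ≥0} (hβ : 1 ≤ β)
    {B : Finset (Option (Fin k × Fin n))} (hB : none ∈ B) (i : Fin k) :
    ∑ C, stepProb (spiderWeight k n c) B C * (legPotential β i C : ℝ≥0∞) ≤
      (((1 + β⁻¹) / 2 : ℝ≥0) : ℝ≥0∞) * (legPotential β i B : ℝ≥0∞) := by
  set w := spiderWeight k n c
  by_cases h0 : legWhite i B = 0
  · refine le_of_eq_of_le (Finset.sum_eq_zero fun C _ => ?_) (zero_le)
    by_cases hs : stepProb w B C = 0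
    · simp [hs]
    · have := legWhite_anti i (subset_of_stepProb_ne_zero w hs)
      have h1 : legWhite i C = 0 := by omega
      simp [legPotential, h1]
  obtain ⟨j, hj, hpred⟩ := exists_first_white hB h0
  obtain ⟨m, hm⟩ := Nat.exists_eq_succ_of_ne_zero h0
  have hp := half_le_turnProb hc B i j hpred
  have hp1 := turnProb_le_one w B (some (i, j))
  calc ∑ C, stepProb w B C * (legPotential β i C : ℝ≥0∞)
      ≤ ∑ C, stepProb w B C *
          (if some (i, j) ∈ C then ((β ^ m : ℝ≥0) : ℝ≥0∞) else ((β ^ (m + 1) : ℝ≥0) : ℝ≥0∞)) := by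
        refine Finset.sum_le_sum fun C _ => ?_
        by_cases hs : stepProb w B C = 0
        · simp [hs]
        have hBC := subset_of_stepProb_ne_zero w hs
        gcongr
        split_ifs with hC
        · have := legWhite_lt hBC hj hC
          exact_mod_cast (legPotential_le β i C).trans (pow_le_pow_right₀ hβ (by omega))
        · have := legWhite_anti i hBC
          exact_mod_cast (legPotential_le β i C).trans (pow_le_pow_right₀ hβ (by omega))
    _ = ((turnProb w B (some (i, j)) * β ^ m +
          (1 - turnProb w B (some (i, j))) * β ^ (m + 1) : ℝ≥0) : ℝ≥0∞) := by
        rw [sum_stepProb_mul_ite]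
        simp [blueProb, whiteProb, hj]
    _ ≤ _ := by
        rw [← ENNReal.coe_mul, ENNReal.coe_le_coe]
        simp only [legPotential, hm, Nat.succ_ne_zero, if_false]
        generalize turnProb w B (some (i, j)) = p at hp hp1
        rw [← NNReal.coe_le_coe]
        have hβ' : (1 : ℝ) ≤ β := by exact_mod_cast hβ
        have hp' : (1 / 2 : ℝ) ≤ p := by exact_mod_cast hp
        push_cast [NNReal.coe_sub hp1]
        have hpow : (0 : ℝ) ≤ (β : ℝ) ^ m := by positivity
        have e : (1 + (β : ℝ)⁻¹) / 2 * (β : ℝ) ^ (m + 1) = (β : ℝ) ^ m * ((β + 1) / 2) := by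
          field_simp
          ring
        rw [Nat.succ_eq_add_one, e]
        have : (β : ℝ) ^ m * (p + (1 - p) * β) ≤ (β : ℝ) ^ m * ((β + 1) / 2) := by
          apply mul_le_mul_of_nonneg_left _ hpow
          nlinarith
        calc _ = (β : ℝ) ^ m * (p + (1 - p) * β) := by ring
          _ ≤ _ := this

theorem unfinishedProb_spider_le (hc : 0 < c) {β : ℝ≥0} (hβ : 1 ≤ β) (t : ℕ) :
    unfinishedProb (spiderWeight k n c) {none} t ≤
      (((1 + β⁻¹) / 2 : ℝ≥0) : ℝ≥0∞) ^ t * ((k * β ^ n : ℝ≥0) : ℝ≥0∞) := by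
  refine (unfinishedProb_le_of_contraction _ {none}
    (fun B => ∑ i, (legPotential β i B : ℝ≥0∞)) (((1 + β⁻¹) / 2 : ℝ≥0) : ℝ≥0∞)
    (fun C hC hne => ?_) (fun B hB => ?_) t).trans ?_
  · obtain ⟨x, hx⟩ : ∃ x, x ∉ C := by
      by_contra! h
      exact hne (Finset.eq_univ_of_forall h)
    rcases x with _ | ⟨i, j⟩
    · exact absurd (hC (Finset.mem_singleton_self _)) hx
    have h0 : legWhite i C ≠ 0 := Finset.card_ne_zero.mpr ⟨j, by simpa⟩
    refine le_trans ?_ (Finset.single_le_sum (fun _ _ => zero_le) (Finset.mem_univ i))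
    simp only [legPotential, h0, if_false]
    exact_mod_cast one_le_pow₀ hβ
  · simp only [Finset.mul_sum]
    rw [Finset.sum_comm]
    exact Finset.sum_le_sum fun i _ =>
      sum_stepProb_mul_legPotential_le hc hβ (hB (Finset.mem_singleton_self _)) i
  · gcongr
    rw [← ENNReal.ofNNReal_finsetSum, ENNReal.coe_le_coe]
    refine (Finset.sum_le_card_nsmul _ _ (β ^ n) fun i _ => ?_).trans (by simp)
    refine (legPotential_le β i _).trans (pow_le_pow_right₀ hβ ?_)
    exact (Finset.card_filter_le _ _).trans (by simp)

theorem pow_mul_pow_le_exp_one {r : ℝ} (hr : 0 < r) {n : ℕ} (hn : r ^ 2 = n) :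
    ((1 + (1 + r⁻¹)⁻¹) / 2) ^ (2 * n) * (1 + r⁻¹) ^ n ≤ Real.exp 1 := by
  have h1 : (1 + (1 + r⁻¹)⁻¹) / 2 ≤ Real.exp (-(1 / (2 * (r + 1)))) := by
    refine le_of_eq_of_le ?_ (Real.add_one_le_exp _)
    field_simp
    ring
  have h2 : 1 + r⁻¹ ≤ Real.exp r⁻¹ := by linarith [Real.add_one_le_exp r⁻¹]
  calc _ ≤ Real.exp (-(1 / (2 * (r + 1)))) ^ (2 * n) * Real.exp r⁻¹ ^ n := by gcongr
    _ = Real.exp (r / (r + 1)) := by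
        rw [← Real.exp_nat_mul, ← Real.exp_nat_mul, ← Real.exp_add]
        congr 1
        push_cast
        rw [← hn]
        field_simp
        ring
    _ ≤ _ := by
        apply Real.exp_le_exp.mpr
        rw [div_le_one (by positivity)]
        linarith

theorem eptMin_spider_le (hc : 0 < c) (hn : 1 ≤ n) :
    eptMin (spiderWeight k n c) ≤ ((2 * n - 1 : ℕ) : ℝ≥0∞) +
      ENNReal.ofReal ((1 + 4 * k * Real.exp 1) * Real.sqrt n) := by
  have hn' : (1 : ℝ) ≤ n := by exact_mod_cast hn
  set r : ℝ := Real.sqrt n with hr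
  have hr1 : 1 ≤ r := Real.one_le_sqrt.mpr hn'
  have hr0 : 0 < r := by linarith
  have hr2 : r ^ 2 = n := Real.sq_sqrt (by positivity)
  set s : ℝ≥0 := r.toNNReal with hs
  set β : ℝ≥0 := 1 + s⁻¹ with hβ
  set ρ : ℝ≥0 := (1 + β⁻¹) / 2 with hρ
  have hgeom := ept_le_of_geometric (spiderWeight k n c) {none} (2 * n) ρ
    ((ρ ^ (2 * n) * (k * β ^ n) : ℝ≥0) : ℝ≥0∞) fun t => by
      refine (unfinishedProb_spider_le hc (β := β) (by simp [hβ]) _).trans_eq ?_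
      rw [pow_add, mul_assoc]
      rw [ENNReal.coe_mul (ρ ^ (2 * n)), ENNReal.coe_pow]
  refine (iInf_le _ none).trans (hgeom.trans ?_)
  have hβr : (β : ℝ) = 1 + r⁻¹ := by simp [hβ, hs, hr0.le]
  have hρr : (ρ : ℝ) = (1 + (1 + r⁻¹)⁻¹) / 2 := by simp [hρ, hβr]
  have hρ1 : 1 - (ρ : ℝ) = 1 / (2 * (r + 1)) := by
    rw [hρr]
    field_simp
    ring
  have hsub : (1 - (ρ : ℝ≥0∞))⁻¹ = ENNReal.ofReal (2 * (r + 1)) := by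
    rw [← ENNReal.ofReal_coe_nnreal, ← ENNReal.ofReal_one, ← ENNReal.ofReal_sub _ ρ.coe_nonneg, hρ1,
      ← ENNReal.ofReal_inv_of_pos (by positivity)]
    simp
  have hA : ((ρ ^ (2 * n) * (k * β ^ n) : ℝ≥0) : ℝ≥0∞) ≤ ENNReal.ofReal (k * Real.exp 1) := by
    rw [← ENNReal.ofReal_coe_nnreal]
    apply ENNReal.ofReal_le_ofReal
    push_cast
    rw [hβr, hρr, mul_left_comm]
    gcongr
    exact pow_mul_pow_le_exp_one hr0 hr2
  calc ((2 * n : ℕ) : ℝ≥0∞) + (1 - (ρ : ℝ≥0∞))⁻¹ * ((ρ ^ (2 * n) * (k * β ^ n) : ℝ≥0) : ℝ≥0∞)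
      ≤ ((2 * n - 1 : ℕ) : ℝ≥0∞) + (ENNReal.ofReal 1 +
          ENNReal.ofReal (2 * (r + 1) * (k * Real.exp 1))) := by
        rw [← add_assoc, hsub, ENNReal.ofReal_mul (by positivity) (q := k * Real.exp 1)]
        gcongr
        rw [ENNReal.ofReal_one]
        exact_mod_cast (by omega : 2 * n ≤ 2 * n - 1 + 1)
    _ ≤ _ := by
        rw [← ENNReal.ofReal_add (by norm_num) (by positivity)]
        gcongr
        have : 0 ≤ k * Real.exp 1 := by positivity
        nlinarith

end Spider

/-- Fix `k > 1`. For the bidirectional spider with `k` legs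
of length `n` and all edge weights equal (to any positive constant `c n`),
`ept_rzf(S_{k,n}) = 2n(1 + o(1))`: more precisely,
`2n - 1 ≤ ept_rzf(S_{k,n}) ≤ 2n - 1 + C_k √n` for a constant `C_k` depending
only on `k`, so `ept_rzf(S_{k,n}) / (2n) → 1` as `n → ∞`. -/
theorem rzf_spider_ept (k : ℕ) (hk : 1 < k) :
    ∃ C : ℝ, ∀ c : ℕ → ℝ≥0, (∀ n, 0 < c n) →
      (∀ n : ℕ, 1 ≤ n →
        ((2 * n - 1 : ℕ) : ℝ≥0∞) ≤ RZF.eptMin (spiderWeight k n (c n)) ∧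
          RZF.eptMin (spiderWeight k n (c n)) ≤
            ((2 * n - 1 : ℕ) : ℝ≥0∞) + ENNReal.ofReal (C * Real.sqrt n)) ∧
      Filter.Tendsto
        (fun n : ℕ => (RZF.eptMin (spiderWeight k n (c n))).toReal / (2 * (n : ℝ)))
        Filter.atTop (nhds 1) := by
  refine ⟨1 + 4 * k * Real.exp 1, fun c hc => ?_⟩
  have hbounds : ∀ n : ℕ, 1 ≤ n →
      ((2 * n - 1 : ℕ) : ℝ≥0∞) ≤ RZF.eptMin (spiderWeight k n (c n)) ∧
        RZF.eptMin (spiderWeight k n (c n)) ≤ ((2 * n - 1 : ℕ) : ℝ≥0∞) +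
          ENNReal.ofReal ((1 + 4 * k * Real.exp 1) * Real.sqrt n) :=
    fun n hn => ⟨le_eptMin_spider hk (hc n), eptMin_spider_le (hc n) hn⟩
  refine ⟨hbounds, ?_⟩
  generalize (1 + 4 * k * Real.exp 1 : ℝ) = D at hbounds
  have hinv : Filter.Tendsto (fun n : ℕ => (n : ℝ)⁻¹) Filter.atTop (nhds 0) :=
    tendsto_inv_atTop_nhds_zero_nat
  have hsqrt : Filter.Tendsto (fun n : ℕ => (Real.sqrt n)⁻¹) Filter.atTop (nhds 0) :=
    (Real.tendsto_sqrt_atTop.comp tendsto_natCast_atTop_atTop).inv_tendsto_atTop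
  have hlow : Filter.Tendsto (fun n : ℕ => 1 - (n : ℝ)⁻¹ / 2) Filter.atTop (nhds 1) := by
    simpa using tendsto_const_nhds.sub (hinv.div_const 2) (a := (1 : ℝ))
  have hup : Filter.Tendsto (fun n : ℕ => 1 - (n : ℝ)⁻¹ / 2 + |D| / 2 * (Real.sqrt n)⁻¹)
      Filter.atTop (nhds 1) := by
    simpa using hlow.add (hsqrt.const_mul (|D| / 2))
  refine tendsto_of_tendsto_of_tendsto_of_le_of_le' hlow hup ?_ ?_
  all_goals
    filter_upwards [Filter.eventually_ge_atTop 1] with n hn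
    obtain ⟨h1, h2⟩ := hbounds n hn
    have hn' : (1 : ℝ) ≤ n := by exact_mod_cast hn
    have hcast : ((2 * n - 1 : ℕ) : ℝ) = 2 * n - 1 := by
      rw [Nat.cast_sub (by omega)]
      push_cast
      ring
    have hfin : ((2 * n - 1 : ℕ) : ℝ≥0∞) + ENNReal.ofReal (D * Real.sqrt n) ≠ ⊤ :=
      ENNReal.add_ne_top.mpr ⟨ENNReal.natCast_ne_top _, ENNReal.ofReal_ne_top⟩
  · have h3 := ENNReal.toReal_mono (ne_top_of_le_ne_top hfin h2) h1
    rw [ENNReal.toReal_natCast, hcast] at h3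
    rw [le_div_iff₀ (by positivity)]
    refine le_of_eq_of_le ?_ h3
    field_simp
  · have h3 := ENNReal.toReal_mono hfin h2
    rw [ENNReal.toReal_add (ENNReal.natCast_ne_top _) ENNReal.ofReal_ne_top, ENNReal.toReal_natCast, hcast] at h3
    have h4 : (ENNReal.ofReal (D * Real.sqrt n)).toReal ≤ |D| * Real.sqrt n := by
      rw [ENNReal.toReal_ofReal']
      exact max_le (by gcongr; exact le_abs_self D) (by positivity)
    rw [div_le_iff₀ (by positivity)]
    refine (h3.trans (add_le_add le_rfl h4)).trans_eq ?_
    have hs : 0 < Real.sqrt n := Real.sqrt_pos.mpr (by linarith)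
    have hs2 : (n : ℝ) = Real.sqrt n * Real.sqrt n := (Real.mul_self_sqrt (by positivity)).symm
    generalize Real.sqrt n = q at *
    rw [hs2]
    field_simp
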